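/- For every integer k ≥ 1, the hat number of the complete digraph on 2^k − 1 vertices satisfies h(K_{2^k − 1}) = (2^k − 1)/2^k. -/

import Mathlib

namespace HatProblem

variable {V : Type*} [Fintype V] [DecidableEq V]

/-- A team strategy: each vertex maps a full configuration to a guess (`none` = pass),
depending only on the colors of its out-neighbors. -/
def IsStrategy (A : V → V → Prop) (S : V → (V → Bool) → Option Bool) : Prop :=
  ∀ (v : V) (c c' : V → Bool), (∀ u, A v u → c u = c' u) → S v c = S v c'

/-- The team wins at configuration `c`: someone guesses correctly, nobody guesses wrong. -/
def Wins (S : V → (V → Bool) → Option Bool) (c : V → Bool) : Prop :=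
  (∃ v, S v c = some (c v)) ∧ ∀ v b, S v c = some b → b = c v

/-- The chance of success of a strategy. -/
noncomputable def chance (S : V → (V → Bool) → Option Bool) : ℚ :=
  ({c : V → Bool | Wins S c}.ncard : ℚ) / 2 ^ Fintype.card V

/-- The hat number of a digraph: the maximal chance of success over all strategies. -/
noncomputable def hatNumber (A : V → V → Prop) : ℚ :=
  haveI : Fintype {S : V → (V → Bool) → Option Bool // IsStrategy A S} :=
    Fintype.ofFinite _
  Finset.sup' (Finset.univ : Finset {S : V → (V → Bool) → Option Bool // IsStrategy A S})
    ⟨⟨fun _ _ => none, fun _ _ _ _ => rfl⟩, Finset.mem_univ _⟩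
    fun S => chance S.1

/-- A clique in the skeleton of a digraph: vertices pairwise joined by arcs both ways. -/
def IsDiClique (A : V → V → Prop) (s : Finset V) : Prop :=
  ∀ x ∈ s, ∀ y ∈ s, x ≠ y → A x y ∧ A y x

/-- The clique number of a digraph: the clique number of its skeleton. -/
noncomputable def cliqueNum (A : V → V → Prop) : ℕ :=
  sSup {n | ∃ s : Finset V, IsDiClique A s ∧ s.card = n}

/-- The directed union `C → D` of two digraphs. -/
def dUnion {W : Type*} (A : V → V → Prop) (B : W → W → Prop) :
    V ⊕ W → V ⊕ W → Prop
  | Sum.inl x, Sum.inl y => A x y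
  | Sum.inl _, Sum.inr _ => True
  | Sum.inr _, Sum.inl _ => False
  | Sum.inr x, Sum.inr y => B x y

/-- The complete digraph on `m` vertices. -/
def completeArc (m : ℕ) : Fin m → Fin m → Prop := fun a b => a ≠ b

end HatProblem

namespace HatProblem

theorem chance_le_hatNumber {V : Type*} [Fintype V] {A : V → V → Prop}
    {S : V → (V → Bool) → Option Bool} (hS : IsStrategy A S) : chance S ≤ hatNumber A :=
  (Finset.le_sup'_iff _).2
    ⟨⟨S, hS⟩, @Finset.mem_univ _ (Fintype.ofFinite _) _, le_refl (chance S)⟩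

section Strategies

variable {V : Type*} [DecidableEq V]

/-- The configuration obtained from `c` by changing the color of `v`. -/
def flipAt (v : V) (c : V → Bool) : V → Bool := Function.update c v (!c v)

theorem flipAt_flipAt (v : V) (c : V → Bool) : flipAt v (flipAt v c) = c := by
  simp [flipAt]

theorem IsStrategy.apply_flipAt {A : V → V → Prop} (hA : ∀ v, ¬ A v v)
    {S : V → (V → Bool) → Option Bool} (hS : IsStrategy A S) (v : V) (c : V → Bool) :
    S v (flipAt v c) = S v c := by
  refine hS v _ _ fun u hu => ?_
  have huv : u ≠ v := by
    rintro rfl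
    exact hA _ hu
  simp [flipAt, huv]

variable [Fintype V]

/-- The winning configurations inject into pairs of a vertex and a losing configuration. -/
theorem IsStrategy.ncard_wins_le {A : V → V → Prop} (hA : ∀ v, ¬ A v v)
    {S : V → (V → Bool) → Option Bool} (hS : IsStrategy A S) :
    {c | Wins S c}.ncard ≤ Fintype.card V * {c | Wins S c}ᶜ.ncard := by
  classical
  rcases isEmpty_or_nonempty V with hV | hV
  · simp [Wins]
  choose! w hw using fun (c : V → Bool) (hc : Wins S c) => hc.1
  rw [← Nat.card_eq_fintype_card, ← Set.ncard_univ, ← Set.ncard_prod]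
  refine Set.ncard_le_ncard_of_injOn (fun c => (w c, flipAt (w c) c)) ?_ ?_
  · intro c hc
    refine ⟨Set.mem_univ _, fun h => ?_⟩
    have h1 := h.2 (w c) (c (w c)) (by rw [hS.apply_flipAt hA, hw c hc])
    simp [flipAt] at h1
  · intro c _ d _ h
    simp only [Prod.mk.injEq] at h
    rw [← flipAt_flipAt (w c) c, h.2, h.1, flipAt_flipAt]

theorem ncard_wins_add_compl (S : V → (V → Bool) → Option Bool) :
    {c | Wins S c}.ncard + {c | Wins S c}ᶜ.ncard = 2 ^ Fintype.card V := by
  rw [Set.ncard_add_ncard_compl, Nat.card_eq_fintype_card]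
  simp

theorem IsStrategy.chance_le {A : V → V → Prop} (hA : ∀ v, ¬ A v v)
    {S : V → (V → Bool) → Option Bool} (hS : IsStrategy A S) :
    chance S ≤ Fintype.card V / (Fintype.card V + 1) := by
  have h1 : ({c | Wins S c}.ncard : ℚ) ≤ Fintype.card V * {c | Wins S c}ᶜ.ncard := by
    exact_mod_cast hS.ncard_wins_le hA
  have h2 : ({c | Wins S c}.ncard : ℚ) + {c | Wins S c}ᶜ.ncard = 2 ^ Fintype.card V := by
    exact_mod_cast ncard_wins_add_compl S
  rw [chance, div_le_div_iff₀ (by positivity) (by positivity), ← h2]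
  linarith

variable {G : Type*} [AddCommGroup G]

/-- The sum of the labels of the vertices colored `true`. -/
def syndrome (e : V → G) (c : V → Bool) : G := ∑ v, if c v then e v else 0

theorem syndrome_update (e : V → G) (c : V → Bool) (v : V) (b : Bool) :
    syndrome e (Function.update c v b) =
      syndrome e c - (if c v then e v else 0) + if b then e v else 0 := by
  have h : ∑ x ∈ Finset.univ.erase v, (if Function.update c v b x then e x else 0) =
      ∑ x ∈ Finset.univ.erase v, if c x then e x else 0 :=
    Finset.sum_congr rfl fun x hx => by
      rw [Function.update_of_ne (Finset.ne_of_mem_erase hx)]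
  rw [syndrome, syndrome, ← Finset.add_sum_erase _ _ (Finset.mem_univ v), h,
    ← Finset.add_sum_erase (a := v) _ (fun x => if c x then e x else 0) (Finset.mem_univ v),
    Function.update_self]
  abel

theorem syndrome_flipAt (hG : ∀ g : G, g + g = 0) (e : V → G) (c : V → Bool) (v : V) :
    syndrome e (flipAt v c) = syndrome e c + e v := by
  have h := neg_eq_of_add_eq_zero_left (hG (e v))
  rw [flipAt, syndrome_update]
  cases c v <;> simp [sub_eq_add_neg, h]

variable [DecidableEq G]

/-- The Hamming strategy: a vertex that could complete its view to a configuration of syndrome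
zero guesses that this is not the actual configuration. -/
def hammingStrategy (e : V → G) (v : V) (c : V → Bool) : Option Bool :=
  if syndrome e (Function.update c v false) = 0 then some true
  else if syndrome e (Function.update c v true) = 0 then some false
  else none

theorem isStrategy_hammingStrategy (e : V → G) :
    IsStrategy (fun a b => a ≠ b) (hammingStrategy e) := by
  intro v c c' h
  have hu (b : Bool) : Function.update c v b = Function.update c' v b := by
    funext u
    by_cases huv : u = v
    · subst huv
      simp
    · simp [huv, h u (Ne.symm huv)]
  simp only [hammingStrategy, hu]

theorem hammingStrategy_eq_some_iff {e : V → G} {v : V} (hv : e v ≠ 0) (c : V → Bool)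
    (b : Bool) :
    hammingStrategy e v c = some b ↔ syndrome e (Function.update c v (!b)) = 0 := by
  have h : syndrome e (Function.update c v false) = 0 →
      syndrome e (Function.update c v true) ≠ 0 := by
    intro h0 h1
    rw [syndrome_update] at h0 h1
    simp only [Bool.false_eq_true, if_false, add_zero] at h0
    rw [h0] at h1
    exact hv (by simpa using h1)
  unfold hammingStrategy
  cases b <;> split_ifs <;> simp_all

theorem wins_hammingStrategy (hG : ∀ g : G, g + g = 0) {e : V → G} (he : ∀ v, e v ≠ 0)
    (hsurj : ∀ g, g ≠ 0 → ∃ v, e v = g) {c : V → Bool} (hc : syndrome e c ≠ 0) :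
    Wins (hammingStrategy e) c := by
  refine ⟨?_, fun v b h => ?_⟩
  · obtain ⟨v, hv⟩ := hsurj _ hc
    refine ⟨v, (hammingStrategy_eq_some_iff (he v) _ _).2 ?_⟩
    change syndrome e (flipAt v c) = 0
    rw [syndrome_flipAt hG, hv, hG]
  · rw [hammingStrategy_eq_some_iff (he v)] at h
    by_contra hb
    have hb' : (!b) = c v := (Bool.eq_not_of_ne (Ne.symm hb)).symm
    rw [hb', Function.update_eq_self] at h
    exact hc h

theorem ncard_syndrome_eq_zero_mul_le (hG : ∀ g : G, g + g = 0) [Fintype G] {e : V → G}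
    (hsurj : ∀ g, g ≠ 0 → ∃ v, e v = g) :
    {c | syndrome e c = 0}.ncard * Fintype.card G ≤ 2 ^ Fintype.card V := by
  choose w hw using hsurj
  have hcard : (Set.univ : Set (V → Bool)).ncard = 2 ^ Fintype.card V := by
    rw [Set.ncard_univ, Nat.card_eq_fintype_card]
    simp
  rw [← Nat.card_eq_fintype_card, ← Set.ncard_univ, ← Set.ncard_prod, ← hcard]
  have key (p : (V → Bool) × G) (hp : syndrome e p.1 = 0) :
      syndrome e (if h : p.2 = 0 then p.1 else flipAt (w p.2 h) p.1) = p.2 := by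
    split_ifs with h
    · rw [hp, h]
    · rw [syndrome_flipAt hG, hp, hw _ h, zero_add]
  refine Set.ncard_le_ncard_of_injOn
    (fun p => if h : p.2 = 0 then p.1 else flipAt (w p.2 h) p.1) (fun _ _ => Set.mem_univ _) ?_
  rintro ⟨c, g⟩ ⟨hc, -⟩ ⟨d, g'⟩ ⟨hd, -⟩ h
  have hg : g = g' := by
    exact (key (c, g) hc).symm.trans ((congrArg (syndrome e) h).trans (key (d, g') hd))
  subst hg
  by_cases h0 : g = 0
  · simpa [h0] using h
  · simp only [h0, dite_false] at h
    rw [← flipAt_flipAt (w g h0) c, h, flipAt_flipAt]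

theorem le_chance_hammingStrategy (hG : ∀ g : G, g + g = 0) [Fintype G] {e : V → G}
    (he : ∀ v, e v ≠ 0) (hsurj : ∀ g, g ≠ 0 → ∃ v, e v = g) :
    ((Fintype.card G : ℚ) - 1) / Fintype.card G ≤ chance (hammingStrategy e) := by
  have h1 : ({c | Wins (hammingStrategy e) c}.ncard : ℚ) +
      {c | Wins (hammingStrategy e) c}ᶜ.ncard = 2 ^ Fintype.card V := by
    exact_mod_cast ncard_wins_add_compl (hammingStrategy e)
  have h2 : ({c | Wins (hammingStrategy e) c}ᶜ.ncard : ℚ) ≤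
      {c | syndrome e c = 0}.ncard := by
    refine Nat.cast_le.2 (Set.ncard_le_ncard fun c hc => ?_)
    by_contra h
    exact hc (wins_hammingStrategy hG he hsurj h)
  have h3 : ({c | syndrome e c = 0}.ncard : ℚ) * Fintype.card G ≤ 2 ^ Fintype.card V := by
    exact_mod_cast ncard_syndrome_eq_zero_mul_le hG hsurj
  have hpos : (0 : ℚ) < Fintype.card G := Nat.cast_pos.2 Fintype.card_pos
  have h4 := mul_le_mul_of_nonneg_right h2 hpos.le
  rw [chance, div_le_div_iff₀ hpos (by positivity), eq_sub_of_add_eq h1, sub_mul, sub_mul,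
    one_mul, mul_comm (Fintype.card G : ℚ)]
  linarith

end Strategies

/-- For every `k ≥ 1`, the complete digraph on `2^k - 1` vertices has hat number
`(2^k - 1)/2^k`. -/
theorem hatNumber_complete_pow_two_sub_one (k : ℕ) (hk : 1 ≤ k) :
    hatNumber (completeArc (2 ^ k - 1)) = ((2 : ℚ) ^ k - 1) / 2 ^ k := by
  have hG (g : Fin k → ZMod 2) : g + g = 0 := by
    funext i
    exact CharTwo.add_self_eq_zero (g i)
  have hcard : Fintype.card {g : Fin k → ZMod 2 // g ≠ 0} = 2 ^ k - 1 := by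
    rw [Fintype.card_subtype_compl, Fintype.card_subtype_eq]
    simp
  let e := (Fintype.equivFinOfCardEq hcard).symm
  refine le_antisymm (Finset.sup'_le _ _ fun S _ => ?_) ?_
  · refine (S.2.chance_le fun v h => h rfl).trans_eq ?_
    simp
  · have h := le_chance_hammingStrategy hG (e := fun v => (e v : Fin k → ZMod 2))
      (fun v => (e v).2) fun g hg => ⟨e.symm ⟨g, hg⟩, by simp⟩
    have hpow : (Fintype.card (Fin k → ZMod 2) : ℚ) = 2 ^ k := by simp
    rw [hpow] at h
    refine h.trans ?_
    exact chance_le_hatNumber (isStrategy_hammingStrategy _)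

end HatProblem
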